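/- Consider N robots with positions x_i : ℝ → EuclideanSpace ℝ (Fin 3), i = 1, …, N, each twice differentiable, masses m_i > 0, local damping coefficients b_i ≥ 0, symmetric inter-robot damping gains β_{i,j} = β_{j,i} ≥ 0 scaled by continuous functions γ_{i,j} = γ_{j,i} : ℝ → ℝ with γ_{i,j}(t) ≥ 0, differentiable symmetric coupling scalings α_{i,j} = α_{j,i} : ℝ → ℝ, continuous external forces F_i : ℝ → EuclideanSpace ℝ (Fin 3), and a continuously differentiable coupling potential V : EuclideanSpace ℝ (Fin 3) → ℝ with V(-y) = V(y) for all y. Suppose m_i x_i''(t) + b_i x_i'(t) + Σ_{j ≠ i} α_{i,j}(t) ∇V(x_i(t) - x_j(t)) + Σ_{j ≠ i} γ_{i,j}(t) β_{i,j} (x_i'(t) - x_j'(t)) = F_i(t) for all i and t. Define the scaled energy H_s(t) = Σ_{i=1}^N (m_i/2)‖x_i'(t)‖² + Σ_{i < j} α_{i,j}(t) V(x_i(t) - x_j(t)). Then H_s is differentiable at every t, with H_s'(t) = Σ_{i=1}^N ⟨F_i(t), x_i'(t)⟩ - Σ_{i=1}^N b_i ‖x_i'(t)‖² - Σ_{i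 < j} γ_{i,j}(t) β_{i,j} ‖x_i'(t) - x_j'(t)‖² + Σ_{i < j} α_{i,j}'(t) V(x_i(t) - x_j(t)). -/

import Mathlib

open MeasureTheory Finset
open scoped RealInnerProductSpace

theorem sum_sum_ne_eq_sum_sum_Ioi {ι M : Type*} [Fintype ι] [LinearOrder ι]
    [LocallyFiniteOrderTop ι] [LocallyFiniteOrderBot ι] [AddCommMonoid M] (f : ι → ι → M) :
    ∑ i, ∑ j ∈ univ.filter (· ≠ i), f i j = ∑ i, ∑ j ∈ Ioi i, (f i j + f j i) := by
  have hsplit (i : ι) : univ.filter (· ≠ i) = (Ioi i).disjUnion (Iio i)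
      (Finset.disjoint_left.2 fun j h h' ↦ lt_asymm (mem_Ioi.1 h) (mem_Iio.1 h')) := by
    ext j
    simp [eq_comm]
  have hswap : ∑ i, ∑ j ∈ Iio i, f i j = ∑ i, ∑ j ∈ Ioi i, f j i :=
    Finset.sum_comm' (by simp)
  simp_rw [hsplit, sum_disjUnion, sum_add_distrib, hswap]

theorem gradient_neg_of_even {E : Type*} [NormedAddCommGroup E] [InnerProductSpace ℝ E]
    [CompleteSpace E] {V : E → ℝ} (heven : ∀ y, V (-y) = V y) (y : E) :
    gradient V (-y) = -gradient V y := by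
  have h : fderiv ℝ V y = -fderiv ℝ V (-y) := by
    simpa [heven] using fderiv_comp_smul (f := V) (x := y) (-1 : ℝ)
  rw [gradient, gradient, h, map_neg, neg_neg]

theorem HasGradientAt.comp_hasDerivAt_inner {E : Type*} [NormedAddCommGroup E]
    [InnerProductSpace ℝ E] [CompleteSpace E] {V : E → ℝ} {g : E} {y : ℝ → E} {y' : E} {t : ℝ}
    (hV : HasGradientAt V g (y t)) (hy : HasDerivAt y y' t) :
    HasDerivAt (fun s ↦ V (y s)) ⟪g, y'⟫ t := by
  simpa [Function.comp_def] using hV.hasFDerivAt.comp_hasDerivAt t hy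

/-- Time-varying energy balance for the scaled multi-robot dynamics
`m_i ẍ_i + b_i ẋ_i + Σ_{j≠i} α_{i,j}(t)∇V(x_i - x_j)
+ Σ_{j≠i} γ_{i,j}(t)β_{i,j}(ẋ_i - ẋ_j) = F_i`: the scaled energy
`H_s = Σ_i (m_i/2)‖ẋ_i‖² + Σ_{i<j} α_{i,j} V(x_i - x_j)` satisfies
`Ḣ_s = Σ_i ⟨F_i, ẋ_i⟩ - Σ_i b_i‖ẋ_i‖² - Σ_{i<j} γ_{i,j}β_{i,j}‖ẋ_i - ẋ_j‖²
+ Σ_{i<j} α̇_{i,j} V(x_i - x_j)`. -/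
theorem stmt_8 (N : ℕ)
    (x x' x'' : Fin N → ℝ → EuclideanSpace ℝ (Fin 3))
    (hx' : ∀ i t, HasDerivAt (x i) (x' i t) t)
    (hx'' : ∀ i t, HasDerivAt (x' i) (x'' i t) t)
    (m : Fin N → ℝ) (hm : ∀ i, 0 < m i)
    (b : Fin N → ℝ) (hb : ∀ i, 0 ≤ b i)
    (β : Fin N → Fin N → ℝ) (hβsymm : ∀ i j, β i j = β j i) (hβ : ∀ i j, 0 ≤ β i j)
    (γ : Fin N → Fin N → ℝ → ℝ) (hγsymm : ∀ i j, γ i j = γ j i)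
    (hγcont : ∀ i j, Continuous (γ i j)) (hγ : ∀ i j t, 0 ≤ γ i j t)
    (α α' : Fin N → Fin N → ℝ → ℝ) (hαsymm : ∀ i j, α i j = α j i)
    (hα' : ∀ i j t, HasDerivAt (α i j) (α' i j t) t)
    (F : Fin N → ℝ → EuclideanSpace ℝ (Fin 3)) (hF : ∀ i, Continuous (F i))
    (V : EuclideanSpace ℝ (Fin 3) → ℝ) (hV : ContDiff ℝ 1 V)
    (hVeven : ∀ y, V (-y) = V y)
    (hdyn : ∀ i t, m i • x'' i t + b i • x' i t
        + (∑ j ∈ univ.filter (· ≠ i), α i j t • gradient V (x i t - x j t))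
        + (∑ j ∈ univ.filter (· ≠ i), (γ i j t * β i j) • (x' i t - x' j t)) = F i t)
    (Hs : ℝ → ℝ)
    (hHs : ∀ t, Hs t = (∑ i, m i / 2 * ‖x' i t‖ ^ 2)
        + ∑ i, ∑ j ∈ Ioi i, α i j t * V (x i t - x j t)) :
    ∀ t, HasDerivAt Hs
      ((∑ i, ⟪F i t, x' i t⟫) - (∑ i, b i * ‖x' i t‖ ^ 2)
        - (∑ i, ∑ j ∈ Ioi i, γ i j t * β i j * ‖x' i t - x' j t‖ ^ 2)
        + ∑ i, ∑ j ∈ Ioi i, α' i j t * V (x i t - x j t)) t := by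
  intro t
  have hgrad (y) : HasGradientAt V (gradient V y) y :=
    (hV.differentiable one_ne_zero y).hasGradientAt
  have hkin (i : Fin N) : HasDerivAt (fun s ↦ m i / 2 * ‖x' i s‖ ^ 2)
      (m i / 2 * (2 * ⟪x' i t, x'' i t⟫)) t :=
    (hx'' i t).norm_sq.const_mul _
  have hpot (i j : Fin N) : HasDerivAt (fun s ↦ α i j s * V (x i s - x j s))
      (α' i j t * V (x i t - x j t)
        + α i j t * ⟪gradient V (x i t - x j t), x' i t - x' j t⟫) t :=
    (hα' i j t).mul ((hgrad _).comp_hasDerivAt_inner ((hx' i t).sub (hx' j t)))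
  have hcoupling : ∑ i, ∑ j ∈ univ.filter (· ≠ i),
        α i j t * ⟪gradient V (x i t - x j t), x' i t⟫
      = ∑ i, ∑ j ∈ Ioi i, α i j t * ⟪gradient V (x i t - x j t), x' i t - x' j t⟫ := by
    rw [sum_sum_ne_eq_sum_sum_Ioi]
    refine sum_congr rfl fun i _ ↦ sum_congr rfl fun j _ ↦ ?_
    rw [hαsymm j i, ← neg_sub (x i t), gradient_neg_of_even hVeven, inner_neg_left,
      inner_sub_right]
    ring
  have hdamping : ∑ i, ∑ j ∈ univ.filter (· ≠ i),
        γ i j t * β i j * ⟪x' i t - x' j t, x' i t⟫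
      = ∑ i, ∑ j ∈ Ioi i, γ i j t * β i j * ‖x' i t - x' j t‖ ^ 2 := by
    rw [sum_sum_ne_eq_sum_sum_Ioi]
    refine sum_congr rfl fun i _ ↦ sum_congr rfl fun j _ ↦ ?_
    rw [hγsymm j i, hβsymm j i, ← neg_sub (x' i t), inner_neg_left,
      ← real_inner_self_eq_norm_sq, inner_sub_right]
    ring
  have hpower : ∑ i, ⟪F i t, x' i t⟫ = (∑ i, m i / 2 * (2 * ⟪x' i t, x'' i t⟫))
      + (∑ i, b i * ‖x' i t‖ ^ 2)
      + (∑ i, ∑ j ∈ Ioi i, α i j t * ⟪gradient V (x i t - x j t), x' i t - x' j t⟫)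
      + ∑ i, ∑ j ∈ Ioi i, γ i j t * β i j * ‖x' i t - x' j t‖ ^ 2 := by
    rw [← hcoupling, ← hdamping, ← sum_add_distrib, ← sum_add_distrib, ← sum_add_distrib]
    refine sum_congr rfl fun i _ ↦ ?_
    rw [← hdyn i t]
    simp only [inner_add_left, sum_inner, real_inner_smul_left, real_inner_self_eq_norm_sq]
    rw [real_inner_comm (x' i t) (x'' i t)]
    ring
  rw [funext hHs]
  refine ((HasDerivAt.fun_sum fun i _ ↦ hkin i).add
    (HasDerivAt.fun_sum fun i _ ↦ HasDerivAt.fun_sum fun j _ ↦ hpot i j)).congr_deriv ?_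
  simp only [sum_add_distrib]
  rw [hpower]
  ring
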